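/- arXiv:1810.01818 — 5 statements merged into one kernel-verified Lean document; each statement's English description precedes it below -/
import Mathlib

section
/- Let k be a finite field, R a Frobenius k-algebra with Frobenius form λ : R → k, ψ : (k,+) → ℂ× a nontrivial additive character, ϖ := ψ ∘ λ, and M a finitely generated R-module. Then the map Hom_R(M, R) → Hom_ℤ((M,+), ℂ×) sending an R-linear map f to the additive character ϖ ∘ f is a bijection (and it is R-linear, where R acts on both sides by (r·f)(m) = f(rm)). -/
/-- A finite abelian group has at most as many `ℂˣ`-valued characters as elements, so an injective
map from the group to its `ℂˣ`-valued characters is bijective. -/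
theorem AddChar.bijective_of_injective_units {A : Type*} [AddCommGroup A] [Finite A]
    {F : A → AddChar A ℂˣ} (hF : Function.Injective F) : Function.Bijective F := by
  let E : AddChar A ℂˣ → AddChar A ℂ := fun χ => (Units.coeHom ℂ).compAddChar χ
  have hE : Function.Injective E := by
    intro χ χ' h
    ext a
    exact DFunLike.congr_fun h a
  have := Fintype.ofFinite A
  have : Fintype (AddChar A ℂˣ) := Fintype.ofInjective E hE
  refine (Fintype.bijective_iff_injective_and_card F).2 ⟨hF, ?_⟩
  refine le_antisymm (Fintype.card_le_of_injective F hF) ?_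
  exact (Fintype.card_le_of_injective E hE).trans_eq AddChar.card_eq

/-- The character `ψ ∘ lam` attached to a Frobenius form is trivial on no nonzero principal
ideal. -/
theorem eq_zero_of_addChar_frobeniusForm_mul_eq_one {k R : Type*} [Field k] [CommRing R]
    [Algebra k R] {lam : R →ₗ[k] k} (hlam : ∀ J : Ideal R, J ≠ ⊥ → ∃ x ∈ J, lam x ≠ 0)
    {ψ : AddChar k ℂˣ} (hψ : ψ ≠ 1) {s : R} (hs : ∀ r, ψ (lam (r * s)) = 1) : s = 0 := by
  by_contra hne
  obtain ⟨x, hx, hx0⟩ := hlam (Ideal.span {s}) (by simpa using hne)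
  obtain ⟨a, rfl⟩ := Ideal.mem_span_singleton'.1 hx
  obtain ⟨c, hc⟩ := AddChar.ne_one_iff.1 hψ
  apply hc
  have h := hs ((c / lam (a * s)) • a)
  rwa [smul_mul_assoc, map_smul, smul_eq_mul, div_mul_cancel₀ _ hx0] at h

/-- Two elements `s`, `t` of a Frobenius algebra agree if the characters `r ↦ ψ (lam (r * s))` and
`r ↦ ψ (lam (r * t))` do. -/
theorem eq_of_addChar_frobeniusForm_mul_eq {k R : Type*} [Field k] [CommRing R]
    [Algebra k R] {lam : R →ₗ[k] k} (hlam : ∀ J : Ideal R, J ≠ ⊥ → ∃ x ∈ J, lam x ≠ 0)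
    {ψ : AddChar k ℂˣ} (hψ : ψ ≠ 1) {s t : R}
    (hst : ∀ r, ψ (lam (r * s)) = ψ (lam (r * t))) : s = t := by
  refine sub_eq_zero.1 (eq_zero_of_addChar_frobeniusForm_mul_eq_one hlam hψ fun r => ?_)
  rw [mul_sub, map_sub, AddChar.map_sub_eq_div, hst, div_self']

/-- Every character of a finite Frobenius algebra has the form `r ↦ ψ (lam (r * s))`. -/
theorem exists_addChar_frobeniusForm_mul_eq {k R : Type*} [Field k] [CommRing R] [Finite R]
    [Algebra k R] {lam : R →ₗ[k] k} (hlam : ∀ J : Ideal R, J ≠ ⊥ → ∃ x ∈ J, lam x ≠ 0)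
    {ψ : AddChar k ℂˣ} (hψ : ψ ≠ 1) (χ : AddChar R ℂˣ) :
    ∃ s, ∀ r, ψ (lam (r * s)) = χ r := by
  let F : R → AddChar R ℂˣ := fun s =>
    ψ.compAddMonoidHom (lam.toAddMonoidHom.comp (AddMonoidHom.mulRight s))
  have hF : Function.Injective F := fun s t h =>
    eq_of_addChar_frobeniusForm_mul_eq hlam hψ fun r => DFunLike.congr_fun h r
  obtain ⟨s, hs⟩ := (AddChar.bijective_of_injective_units hF).2 χ
  exact ⟨s, fun r => DFunLike.congr_fun hs r⟩


/-- Let `R` be a Frobenius algebra over a finite field `k` with Frobenius form `λ`, let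
`ψ : (k,+) → ℂ×` be a nontrivial additive character, `ϖ := ψ ∘ λ`, and `M` a finitely
generated `R`-module.  Then the map `Hom_R(M,R) → Hom_ℤ((M,+), ℂ×)`, `f ↦ ϖ ∘ f`, is a
bijection, and it is `R`-linear for the actions `(r·f)(m) = f(r m)` on both sides. -/
theorem dual_module_iso_pontryagin_dual
    (k : Type) [Field k] [Fintype k]
    (R : Type) [CommRing R] [Algebra k R] [FiniteDimensional k R]
    (lam : R →ₗ[k] k) (hlam : ∀ J : Ideal R, J ≠ ⊥ → ∃ x ∈ J, lam x ≠ 0)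
    (ψ : AddChar k ℂˣ) (hψ : ψ ≠ 1)
    (M : Type) [AddCommGroup M] [Module R M] [Module.Finite R M] :
    Function.Bijective (fun f : M →ₗ[R] R =>
      AddChar.compAddMonoidHom (ψ.compAddMonoidHom lam.toAddMonoidHom) f.toAddMonoidHom) ∧
    ∀ (r : R) (f : M →ₗ[R] R) (m : M),
      AddChar.compAddMonoidHom (ψ.compAddMonoidHom lam.toAddMonoidHom)
          (r • f).toAddMonoidHom m =
        AddChar.compAddMonoidHom (ψ.compAddMonoidHom lam.toAddMonoidHom)
          f.toAddMonoidHom (r • m) := by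
  have : Finite R := Module.finite_of_finite k
  refine ⟨⟨fun f g h => ?_, fun χ => ?_⟩, fun r f m => ?_⟩
  · ext m
    refine eq_of_addChar_frobeniusForm_mul_eq hlam hψ fun r => ?_
    have h' : ψ (lam (f (r • m))) = ψ (lam (g (r • m))) := DFunLike.congr_fun h (r • m)
    simpa only [map_smul, smul_eq_mul] using h'
  · have hex (m : M) : ∃ s, ∀ r : R, ψ (lam (r * s)) = χ (r • m) :=
      exists_addChar_frobeniusForm_mul_eq hlam hψ
        (χ.compAddMonoidHom ((smulAddHom R M).flip m))
    choose f hf using hex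
    refine ⟨⟨⟨f, fun m n => ?_⟩, fun a m => ?_⟩, ?_⟩
    · refine eq_of_addChar_frobeniusForm_mul_eq hlam hψ fun r => ?_
      rw [mul_add, map_add, AddChar.map_add_eq_mul, hf, hf, hf, smul_add,
        AddChar.map_add_eq_mul]
    · refine eq_of_addChar_frobeniusForm_mul_eq hlam hψ fun r => ?_
      rw [RingHom.id_apply, smul_eq_mul, ← mul_assoc, hf, hf, mul_smul]
    · refine DFunLike.ext _ _ fun m => ?_
      have h := hf m 1
      rw [one_mul, one_smul] at h
      exact h
  · change ψ (lam (r • f m)) = ψ (lam (f (r • m)))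
    rw [map_smul f]
end

section
/- Let k be a finite field, R a Frobenius k-algebra, and M a finitely generated R-module. Then M is reflexive: the canonical R-linear map M → Hom_R(Hom_R(M,R), R), sending m to the evaluation map f ↦ f(m), is an isomorphism of R-modules. -/
namespace FrobeniusForm

variable {k R M : Type*} [Field k] [CommRing R] [Algebra k R]
  [AddCommGroup M] [Module R M] [Module k M] [IsScalarTower k R M]
  {lam : R →ₗ[k] k}

/-- Elements of `R` are separated by the functionals `r ↦ lam (r * a)`. -/
theorem eq_of_forall_apply_mul_eq (hlam : ∀ J : Ideal R, J ≠ ⊥ → ∃ x ∈ J, lam x ≠ 0)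
    {a b : R} (h : ∀ r, lam (r * a) = lam (r * b)) : a = b := by
  by_contra hab
  obtain ⟨x, hx, hx0⟩ := hlam (Ideal.span {a - b}) (by
    simpa [Ideal.span_singleton_eq_bot, sub_eq_zero] using hab)
  obtain ⟨r, rfl⟩ := Ideal.mem_span_singleton'.1 hx
  exact hx0 (by rw [mul_sub, map_sub, h, sub_self])

/-- Every functional on a Frobenius algebra is of the form `r ↦ lam (r * a)`. -/
theorem exists_forall_apply_mul_eq [FiniteDimensional k R]
    (hlam : ∀ J : Ideal R, J ≠ ⊥ → ∃ x ∈ J, lam x ≠ 0) (g : Module.Dual k R) :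
    ∃ a, ∀ r, lam (r * a) = g r := by
  let S : R →ₗ[k] Module.Dual k R := (LinearMap.mul k R).flip.compr₂ lam
  have hS : Function.Injective S := fun a b h =>
    eq_of_forall_apply_mul_eq hlam fun r => LinearMap.congr_fun h r
  obtain ⟨a, ha⟩ := (LinearMap.injective_iff_surjective_of_finrank_eq_finrank
    (Subspace.dual_finrank_eq (K := k) (V := R)).symm).1 hS g
  exact ⟨a, fun r => LinearMap.congr_fun ha r⟩

variable (M) in
/-- Postcomposition with a linear form on `R`, from the `R`-dual to the `k`-dual. -/
def dualMap (lam : R →ₗ[k] k) : Module.Dual R M →ₗ[k] Module.Dual k M where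
  toFun f := lam ∘ₗ f.restrictScalars k
  map_add' f g := by ext; simp
  map_smul' c f := by ext; simp

@[simp]
theorem dualMap_apply (f : Module.Dual R M) (m : M) : dualMap M lam f m = lam (f m) := rfl

theorem dualMap_bijective [FiniteDimensional k R]
    (hlam : ∀ J : Ideal R, J ≠ ⊥ → ∃ x ∈ J, lam x ≠ 0) :
    Function.Bijective (dualMap M lam) := by
  refine ⟨fun f g h => LinearMap.ext fun m => eq_of_forall_apply_mul_eq hlam fun r => ?_,
    fun g => ?_⟩
  · simpa using LinearMap.congr_fun h (r • m)
  · choose f hf using fun m : M => exists_forall_apply_mul_eq hlam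
      (g ∘ₗ (LinearMap.toSpanSingleton R M m).restrictScalars k)
    have hf' (m : M) (r : R) : lam (r * f m) = g (r • m) := hf m r
    refine ⟨{ toFun := f, map_add' := fun x y => ?_, map_smul' := fun c x => ?_ },
      LinearMap.ext fun m => ?_⟩
    · exact eq_of_forall_apply_mul_eq hlam fun r => by simp [mul_add, hf']
    · exact eq_of_forall_apply_mul_eq hlam fun r => by
        rw [hf', RingHom.id_apply, smul_eq_mul, ← mul_assoc, hf', mul_smul]
    · simpa using hf' m 1

theorem dual_eval_bijective [FiniteDimensional k R] [FiniteDimensional k M]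
    (hlam : ∀ J : Ideal R, J ≠ ⊥ → ∃ x ∈ J, lam x ≠ 0) :
    Function.Bijective (Module.Dual.eval R M) := by
  refine ⟨fun x y h => Module.eval_apply_injective k (LinearMap.ext fun g => ?_), fun Φ => ?_⟩
  · obtain ⟨f, rfl⟩ := (dualMap_bijective hlam).2 g
    exact congrArg lam (LinearMap.congr_fun h f)
  · let T := LinearEquiv.ofBijective (dualMap M lam) (dualMap_bijective hlam)
    obtain ⟨m, hm⟩ := (Module.bijective_dual_eval k M).2
      (lam ∘ₗ Φ.restrictScalars k ∘ₗ T.symm.toLinearMap)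
    have key (f : Module.Dual R M) : lam (f m) = lam (Φ f) := by
      simpa [T] using LinearMap.congr_fun hm (T f)
    exact ⟨m, LinearMap.ext fun f => eq_of_forall_apply_mul_eq hlam fun r => by
      simpa using key (r • f)⟩

end FrobeniusForm

/-- Every finitely generated module `M` over a Frobenius algebra `R` over a finite field `k`
is reflexive: the canonical evaluation map `M → Hom_R(Hom_R(M,R), R)` is an isomorphism of
`R`-modules (it is `R`-linear by construction, and here we assert it is bijective). -/
theorem finitely_generated_module_over_frobenius_algebra_is_reflexive
    (k : Type) [Field k] [Fintype k]
    (R : Type) [CommRing R] [Algebra k R] [FiniteDimensional k R]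
    (lam : R →ₗ[k] k) (hlam : ∀ J : Ideal R, J ≠ ⊥ → ∃ x ∈ J, lam x ≠ 0)
    (M : Type) [AddCommGroup M] [Module R M] [Module.Finite R M] :
    Function.Bijective (Module.Dual.eval R M) := by
  let _ : Module k M := Module.compHom M (algebraMap k R)
  have : IsScalarTower k R M := IsScalarTower.of_algebraMap_smul fun _ _ => rfl
  have : FiniteDimensional k M := Module.Finite.trans R M
  exact FrobeniusForm.dual_eval_bijective hlam
end

section
/- Let k be a finite field, R a Frobenius k-algebra, and M a finitely generated R-module with dual M^∨ := Hom_R(M,R). Let a finite group G act on M by R-module automorphisms (a group homomorphism G → Aut_R(M)) and also act on a finite set X; let G act on M^∨ by (g·f)(m) := f(g⁻¹·m). Then the number of G-orbits on X × M (diagonal action) equals the number of G-orbits on X × M^∨ (diagonal action). -/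
theorem MulAction.natCard_orbit_subsets (G Y : Type*) [Group G] [MulAction G Y] :
    Nat.card {O : Set Y // ∃ p : Y, O = MulAction.orbit G p} =
      Nat.card (MulAction.orbitRel.Quotient G Y) := by
  symm
  refine Nat.card_congr (Equiv.ofBijective
    (fun q ↦ ⟨q.orbit, Quotient.inductionOn' q fun p ↦ ⟨p, rfl⟩⟩) ⟨fun a b h ↦ ?_, ?_⟩)
  · exact MulAction.orbitRel.Quotient.orbit_injective (congrArg Subtype.val h)
  · rintro ⟨_, p, rfl⟩
    exact ⟨Quotient.mk'' p, rfl⟩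

theorem MulAction.natCard_quotient_mul_natCard (G Y : Type*) [Group G] [Finite G]
    [Finite Y] [MulAction G Y] :
    Nat.card (MulAction.orbitRel.Quotient G Y) * Nat.card G =
      ∑ᶠ g : G, Nat.card (MulAction.fixedBy Y g) := by
  classical
  have := Fintype.ofFinite G
  have := Fintype.ofFinite Y
  have := Fintype.ofFinite (MulAction.orbitRel.Quotient G Y)
  simp only [finsum_eq_sum_of_fintype, Nat.card_eq_fintype_card]
  exact (MulAction.sum_card_fixedBy_eq_card_orbits_mul_card_group G Y).symm

theorem MulAction.natCard_fixedBy_prod {G : Type*} (X Y : Type*) [Group G] [MulAction G X]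
    [MulAction G Y] (g : G) :
    Nat.card (MulAction.fixedBy (X × Y) g) =
      Nat.card (MulAction.fixedBy X g) * Nat.card (MulAction.fixedBy Y g) := by
  have fixedBy_prod :
      MulAction.fixedBy (X × Y) g = MulAction.fixedBy X g ×ˢ MulAction.fixedBy Y g := by
    ext ⟨x, y⟩
    simp [MulAction.mem_fixedBy, Prod.ext_iff]
  rw [fixedBy_prod, Nat.card_congr (Equiv.Set.prod _ _), Nat.card_prod]

/-- Brauer's permutation lemma with an auxiliary factor: if every element of `G` has equally many
fixed points on `Y` and `Z`, then `X × Y` and `X × Z` have equally many orbits. -/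
theorem MulAction.natCard_orbits_prod_congr (G X Y Z : Type*) [Group G] [Finite G]
    [Finite X] [Finite Y] [Finite Z] [MulAction G X] [MulAction G Y] [MulAction G Z]
    (h : ∀ g : G, Nat.card (MulAction.fixedBy Y g) = Nat.card (MulAction.fixedBy Z g)) :
    Nat.card (MulAction.orbitRel.Quotient G (X × Y)) =
      Nat.card (MulAction.orbitRel.Quotient G (X × Z)) := by
  refine Nat.eq_of_mul_eq_mul_right (Nat.card_pos (α := G)) ?_
  rw [natCard_quotient_mul_natCard, natCard_quotient_mul_natCard]
  refine finsum_congr fun g ↦ ?_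
  rw [natCard_fixedBy_prod, natCard_fixedBy_prod, h]

section Frobenius

variable {k R : Type*} [Field k] [CommRing R] [Algebra k R]

theorem eq_zero_of_frobenius_form (lam : R →ₗ[k] k)
    (hlam : ∀ J : Ideal R, J ≠ ⊥ → ∃ x ∈ J, lam x ≠ 0) {a : R}
    (h : ∀ r, lam (r * a) = 0) : a = 0 := by
  by_contra ha
  obtain ⟨x, hx, hx0⟩ := hlam (Ideal.span {a}) (by simpa using ha)
  obtain ⟨r, rfl⟩ := Ideal.mem_span_singleton'.1 hx
  exact hx0 (h r)

theorem exists_frobenius_form_eq [FiniteDimensional k R] (lam : R →ₗ[k] k)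
    (hlam : ∀ J : Ideal R, J ≠ ⊥ → ∃ x ∈ J, lam x ≠ 0)
    (φ : R →ₗ[k] k) : ∃ a, ∀ r, lam (r * a) = φ r := by
  let B : R →ₗ[k] Module.Dual k R := ((LinearMap.mul k R).compr₂ lam).flip
  have hB : Function.Injective B := (injective_iff_map_eq_zero B).2 fun a ha ↦
    eq_zero_of_frobenius_form lam hlam fun r ↦ DFunLike.congr_fun ha r
  have hB' : Function.Surjective B :=
    (LinearMap.injective_iff_surjective_of_finrank_eq_finrank
      Subspace.dual_finrank_eq.symm).1 hB
  obtain ⟨a, ha⟩ := hB' φ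
  exact ⟨a, fun r ↦ DFunLike.congr_fun ha r⟩

theorem bijective_comp_frobenius_form [FiniteDimensional k R] (lam : R →ₗ[k] k)
    (hlam : ∀ J : Ideal R, J ≠ ⊥ → ∃ x ∈ J, lam x ≠ 0)
    (N : Type*) [AddCommGroup N] [Module R N] [Module k N]
    [IsScalarTower k R N] :
    Function.Bijective fun f : N →ₗ[R] R ↦ lam ∘ₗ f.restrictScalars k := by
  have ext_form {a b : R} (h : ∀ r, lam (r * a) = lam (r * b)) : a = b :=
    sub_eq_zero.1 <| eq_zero_of_frobenius_form lam hlam fun r ↦ by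
      rw [mul_sub, map_sub, h, sub_self]
  constructor
  · intro f g h
    ext n
    refine ext_form fun r ↦ ?_
    simpa using DFunLike.congr_fun h (r • n)
  · intro φ
    choose f hf using fun n : N ↦ exists_frobenius_form_eq lam hlam
      (φ ∘ₗ (LinearMap.toSpanSingleton R N n).restrictScalars k)
    replace hf (n : N) (r : R) : lam (r * f n) = φ (r • n) := hf n r
    refine ⟨{ toFun := f, map_add' := fun m n ↦ ?_, map_smul' := fun s n ↦ ?_ }, ?_⟩
    · exact ext_form fun r ↦ by simp [mul_add, hf]
    · exact ext_form fun r ↦ by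
        rw [hf, RingHom.id_apply, smul_eq_mul, ← mul_assoc, hf, mul_smul]
    · ext n
      simpa using hf n 1

theorem natCard_dual_of_frobenius [Finite k] [FiniteDimensional k R] (lam : R →ₗ[k] k)
    (hlam : ∀ J : Ideal R, J ≠ ⊥ → ∃ x ∈ J, lam x ≠ 0)
    (N : Type*) [AddCommGroup N] [Module R N]
    [Module.Finite R N] : Nat.card (N →ₗ[R] R) = Nat.card N := by
  let _ : Module k N := Module.compHom N (algebraMap k R)
  have : IsScalarTower k R N := IsScalarTower.of_algebraMap_smul fun _ _ ↦ rfl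
  have : Module.Finite k N := Module.Finite.trans R N
  rw [Nat.card_congr (Equiv.ofBijective _ (bijective_comp_frobenius_form lam hlam N)),
    Module.natCard_eq_pow_finrank (K := k), Module.natCard_eq_pow_finrank (K := k) (V := N)]
  exact congrArg _ Subspace.dual_finrank_eq

/-- A linear endomorphism has as many fixed points as its transpose. -/
theorem natCard_fixed_dual_of_frobenius [Finite k] [FiniteDimensional k R] (lam : R →ₗ[k] k)
    (hlam : ∀ J : Ideal R, J ≠ ⊥ → ∃ x ∈ J, lam x ≠ 0)
    (N : Type*) [AddCommGroup N] [Module R N]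
    [Module.Finite R N] [Finite N] (T : N →ₗ[R] N) :
    Nat.card {n : N // T n = n} = Nat.card {f : N →ₗ[R] R // f ∘ₗ T = f} := by
  let D := T - LinearMap.id
  have hker : Nat.card {n : N // T n = n} = Nat.card (LinearMap.ker D) :=
    Nat.card_congr (Equiv.subtypeEquivRight fun n ↦ by simp [D, sub_eq_zero])
  have hdual : Nat.card {f : N →ₗ[R] R // f ∘ₗ T = f} =
      Nat.card ((N ⧸ LinearMap.range D) →ₗ[R] R) := by
    symm
    refine Nat.card_congr (Equiv.ofBijective
      (fun f ↦ ⟨f ∘ₗ (LinearMap.range D).mkQ, ?_⟩) ⟨fun f g h ↦ ?_, ?_⟩)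
    · ext n
      refine congrArg f ((Submodule.Quotient.eq _).2 ⟨n, rfl⟩)
    · exact Submodule.linearMap_qext _ (congrArg Subtype.val h)
    · rintro ⟨f, hf⟩
      refine ⟨(LinearMap.range D).liftQ f ?_, Subtype.ext (Submodule.liftQ_mkQ _ _ _)⟩
      rintro _ ⟨n, rfl⟩
      simpa [D, sub_eq_zero] using DFunLike.congr_fun hf n
  rw [hker, hdual, natCard_dual_of_frobenius lam hlam]
  refine Nat.eq_of_mul_eq_mul_right (Nat.card_pos (α := LinearMap.range D)) ?_
  rw [mul_comm (Nat.card (_ ⧸ _)), ← Submodule.card_eq_card_quotient_mul_card,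
    Submodule.card_eq_card_quotient_mul_card (LinearMap.ker D),
    Nat.card_congr D.quotKerEquivRange.toEquiv]

end Frobenius

/-- (Brauer-type lemma.)  Let `R` be a Frobenius algebra over a finite field `k`, `M` a
finitely generated `R`-module, `G` a finite group acting on `M` by `R`-module automorphisms
(via `ρ : G →* (M ≃ₗ[R] M)`) and acting on a finite set `X`.  Let `G` act on the dual
module `M^∨ = Hom_R(M,R)` by `(g·f)(m) = f(ρ(g⁻¹) m)`.  Then the number of `G`-orbits on
`X × M` equals the number of `G`-orbits on `X × M^∨` (orbits counted as orbit subsets). -/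
theorem card_orbits_eq_card_orbits_dual
    (k : Type) [Field k] [Fintype k]
    (R : Type) [CommRing R] [Algebra k R] [FiniteDimensional k R]
    (lam : R →ₗ[k] k) (hlam : ∀ J : Ideal R, J ≠ ⊥ → ∃ x ∈ J, lam x ≠ 0)
    (M : Type) [AddCommGroup M] [Module R M] [Module.Finite R M]
    (G : Type) [Group G] [Finite G] (ρ : G →* (M ≃ₗ[R] M))
    (X : Type) [Finite X] [MulAction G X] :
    Nat.card {O : Set (X × M) //
        ∃ p : X × M, O = {q | ∃ g : G, q.1 = g • p.1 ∧ q.2 = ρ g p.2}} =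
      Nat.card {O : Set (X × (M →ₗ[R] R)) //
        ∃ p : X × (M →ₗ[R] R),
          O = {q | ∃ g : G, q.1 = g • p.1 ∧ q.2 = p.2.comp (ρ g⁻¹ : M ≃ₗ[R] M).toLinearMap}} := by
  have : Finite R := Module.finite_of_finite k
  have : Finite M := Module.finite_of_finite R
  have : Finite (M →ₗ[R] R) := DFunLike.finite _
  let _ : MulAction G M := MulAction.compHom M ρ
  let _ : MulAction G (M →ₗ[R] R) :=
    { smul := fun g f ↦ f ∘ₗ (ρ g⁻¹).toLinearMap
      one_smul := fun f ↦ by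
        ext m
        change f (ρ 1⁻¹ m) = f m
        simp
      mul_smul := fun g h f ↦ by
        ext m
        change f (ρ (g * h)⁻¹ m) = f (ρ h⁻¹ (ρ g⁻¹ m))
        simp [mul_inv_rev] }
  have fixedBy_card (g : G) : Nat.card (MulAction.fixedBy M g) =
      Nat.card (MulAction.fixedBy (M →ₗ[R] R) g) := by
    rw [← MulAction.fixedBy_inv]
    exact natCard_fixed_dual_of_frobenius lam hlam M (ρ g⁻¹).toLinearMap
  have orbits_card := MulAction.natCard_orbits_prod_congr G X M (M →ₗ[R] R) fixedBy_card
  rw [← MulAction.natCard_orbit_subsets, ← MulAction.natCard_orbit_subsets] at orbits_card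
  convert orbits_card using 7 <;>
  · ext q
    exact exists_congr fun g ↦ (Prod.ext_iff (x := q) (y := g • _)).symm.trans eq_comm
end

section
/- Let k be a finite field, R a Frobenius k-algebra, Q = (I, E, s, t) a finite quiver, and α : I → ℕ a rank vector. Let Q' = (I, E, s', t') be obtained from Q by changing the orientation of some arrows, i.e. for each a ∈ E either (s'(a), t'(a)) = (s(a), t(a)) or (s'(a), t'(a)) = (t(a), s(a)). Then m_α(RQ) = m_α(RQ'): the number of G_α(R)-orbits on Rep^α(Q,R) equals the number of G_α(R)-orbits on Rep^α(Q',R). -/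
open Matrix

/-- The space of locally free representations of rank `α` of the quiver with vertex set `I`,
arrow set `E`, source map `s` and target map `t`, over the commutative ring `S`:
a matrix of size `α (t a) × α (s a)` for each arrow `a`. -/
abbrev QRep (I E : Type) (s t : E → I) (α : I → ℕ) (S : Type) [CommRing S] : Type :=
  ∀ a : E, Matrix (Fin (α (t a))) (Fin (α (s a))) S

/-- The group `G_α(S) = ∏_i GL_{α i}(S)`. -/
abbrev QGl (I : Type) (α : I → ℕ) (S : Type) [CommRing S] : Type :=
  ∀ i : I, (Matrix (Fin (α i)) (Fin (α i)) S)ˣ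

/-- The action of `G_α(S)` on representations: `(g • M)_a = g_{t a} * M_a * g_{s a}⁻¹`. -/
def QAct {I E : Type} (s t : E → I) (α : I → ℕ) {S : Type} [CommRing S]
    (g : QGl I α S) (M : QRep I E s t α S) : QRep I E s t α S :=
  fun a => (g (t a)).val * M a * (g (s a)).inv

/-- `m_α(SQ)`: the number of `G_α(S)`-orbits on `Rep^α(Q,S)`, counted as the number of
orbit subsets. -/
noncomputable def mOrbits (I E : Type) (s t : E → I) (α : I → ℕ) (S : Type) [CommRing S] : ℕ :=
  Nat.card {O : Set (QRep I E s t α S) //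
    ∃ M : QRep I E s t α S, O = {N | ∃ g : QGl I α S, N = QAct s t α g M}}

/-- Matrices intertwining `B` and `A` and matrices intertwining `A` and `B` are equinumerous over a
finite Frobenius algebra: the maps `M ↦ A * M - M * B` and `N ↦ N * A - B * N` are adjoint for the
nondegenerate pairing `(M, N) ↦ lam (trace (M * N))`. -/
theorem card_intertwiners_comm {k R : Type*} [Field k] [Finite k] [CommRing R] [Algebra k R]
    [FiniteDimensional k R] (lam : R →ₗ[k] k) (hlam : ∀ J : Ideal R, J ≠ ⊥ → ∃ x ∈ J, lam x ≠ 0)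
    {m n : Type*} [Fintype m] [Fintype n] [DecidableEq m] [DecidableEq n]
    (A : Matrix m m R) (B : Matrix n n R) :
    Nat.card {M : Matrix m n R // A * M = M * B} =
      Nat.card {N : Matrix n m R // B * N = N * A} := by
  let T : Matrix m n R →ₗ[k] Matrix m n R :=
    { toFun := fun M => A * M - M * B
      map_add' := fun x y => by rw [Matrix.mul_add, Matrix.add_mul]; abel
      map_smul' := fun c x => by simp [smul_sub] }
  let T' : Matrix n m R →ₗ[k] Matrix n m R :=
    { toFun := fun N => N * A - B * N
      map_add' := fun x y => by rw [Matrix.mul_add, Matrix.add_mul]; abel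
      map_smul' := fun c x => by simp [smul_sub] }
  let Φ : Matrix n m R →ₗ[k] Module.Dual k (Matrix m n R) :=
    LinearMap.mk₂ k (fun N M => lam (Matrix.trace (M * N)))
      (fun N N' M => by simp [Matrix.mul_add]) (fun c N M => by simp)
      (fun N M M' => by simp [Matrix.add_mul]) (fun c N M => by simp)
  have hΦ : Function.Injective Φ := by
    rw [injective_iff_map_eq_zero]
    intro N hN
    ext i j
    by_contra hij
    obtain ⟨x, hx, hne⟩ := hlam (Ideal.span {N i j})
      (by simpa [Ideal.span_singleton_eq_bot] using hij)
    obtain ⟨r, rfl⟩ := Ideal.mem_span_singleton'.1 hx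
    have h := LinearMap.congr_fun hN (Matrix.single j i r)
    exact hne (by simpa [Φ, Matrix.trace_single_mul] using h)
  have hdim : Module.finrank k (Matrix n m R) = Module.finrank k (Matrix m n R) :=
    (Matrix.transposeLinearEquiv n m k R).finrank_eq
  have hsurj : Function.Surjective Φ :=
    (LinearMap.injective_iff_surjective_of_finrank_eq_finrank
      (hdim.trans Subspace.dual_finrank_eq.symm)).1 hΦ
  have hcomp : T.dualMap ∘ₗ Φ = Φ ∘ₗ T' := by
    ext N M
    change lam (trace ((A * M - M * B) * N)) = lam (trace (M * (N * A - B * N)))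
    congr 1
    rw [Matrix.sub_mul, Matrix.mul_sub, trace_sub, trace_sub, Matrix.mul_assoc A, trace_mul_comm A,
      Matrix.mul_assoc, Matrix.mul_assoc]
  have hrange : Module.finrank k (LinearMap.range T') = Module.finrank k (LinearMap.range T) := by
    rw [← LinearMap.finrank_range_dualMap_eq_finrank_range T,
      ← LinearMap.range_comp_of_range_eq_top T.dualMap (LinearMap.range_eq_top.2 hsurj), hcomp,
      LinearMap.range_comp, ← (Submodule.equivMapOfInjective Φ hΦ (LinearMap.range T')).finrank_eq]
  have hker : Module.finrank k (LinearMap.ker T) = Module.finrank k (LinearMap.ker T') := by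
    have h := T.finrank_range_add_finrank_ker
    have h' := T'.finrank_range_add_finrank_ker
    omega
  calc
    _ = Nat.card (LinearMap.ker T) :=
      Nat.card_congr (Equiv.subtypeEquivRight fun M => sub_eq_zero.symm)
    _ = Nat.card (LinearMap.ker T') := by
      rw [Module.natCard_eq_pow_finrank (K := k), hker, ← Module.natCard_eq_pow_finrank (K := k)]
    _ = _ := (Nat.card_congr (Equiv.subtypeEquivRight fun N => eq_comm.trans sub_eq_zero.symm)).symm

/-- The action of `G_α(S)` on `Rep^α(Q,S)` as a `MulAction`. -/
abbrev QRep.mulAction {I E : Type} (s t : E → I) (α : I → ℕ) (S : Type) [CommRing S] :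
    MulAction (QGl I α S) (QRep I E s t α S) where
  smul := QAct s t α
  one_smul M := by
    funext a
    change (1 : Matrix (Fin (α (t a))) (Fin (α (t a))) S) * M a *
      (1 : Matrix (Fin (α (s a))) (Fin (α (s a))) S) = M a
    simp
  mul_smul g h M := by
    funext a
    change ((g (t a)).val * (h (t a)).val) * M a * ((h (s a)).inv * (g (s a)).inv) =
      (g (t a)).val * ((h (t a)).val * M a * (h (s a)).inv) * (g (s a)).inv
    simp only [Matrix.mul_assoc]

theorem mOrbits_eq_card_quotient {I E : Type} (s t : E → I) (α : I → ℕ) (S : Type) [CommRing S] :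
    letI := QRep.mulAction s t α S
    mOrbits I E s t α S =
      Nat.card (MulAction.orbitRel.Quotient (QGl I α S) (QRep I E s t α S)) := by
  let _ := QRep.mulAction s t α S
  have horb (M : QRep I E s t α S) :
      {N | ∃ g : QGl I α S, N = QAct s t α g M} = MulAction.orbit (QGl I α S) M :=
    Set.ext fun N => exists_congr fun g => eq_comm
  refine (Nat.card_congr (Equiv.ofBijective
    (Quotient.lift (fun M => ⟨MulAction.orbit (QGl I α S) M, M, (horb M).symm⟩)
      fun M N h => Subtype.ext (MulAction.orbit_eq_iff.2 h)) ⟨?_, ?_⟩)).symm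
  · rintro ⟨M⟩ ⟨N⟩ h
    exact Quotient.sound (MulAction.orbit_eq_iff.1 (congrArg Subtype.val h))
  · rintro ⟨O, M, rfl⟩
    exact ⟨Quotient.mk _ M, Subtype.ext (horb M).symm⟩

theorem card_fixedBy_QRep {I E : Type} [Fintype E] (s t : E → I) (α : I → ℕ) (S : Type)
    [CommRing S] (g : QGl I α S) :
    letI := QRep.mulAction s t α S
    Nat.card (MulAction.fixedBy (QRep I E s t α S) g) =
      ∏ a, Nat.card {M : Matrix (Fin (α (t a))) (Fin (α (s a))) S //
        (g (t a)).val * M = M * (g (s a)).val} := by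
  let _ := QRep.mulAction s t α S
  rw [← Nat.card_pi]
  refine Nat.card_congr (Equiv.trans (Equiv.subtypeEquivRight fun M => ?_)
    Equiv.subtypePiEquivPi)
  refine funext_iff.trans (forall_congr' fun a => ?_)
  change (g (t a)).val * M a * (g (s a)).inv = M a ↔ _
  constructor
  · intro h
    rw [← h, Matrix.mul_assoc _ (g (s a)).inv, (g (s a)).inv_val, Matrix.mul_one, h]
  · intro h
    rw [h, Matrix.mul_assoc, (g (s a)).val_inv, Matrix.mul_one]

/-- Burnside's lemma for the action of `G_α(S)` on `Rep^α(Q,S)`. -/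
theorem mOrbits_mul_card_QGl {I E : Type} [Fintype I] [Fintype E] (s t : E → I) (α : I → ℕ)
    (S : Type) [CommRing S] [Finite S] [Fintype (QGl I α S)] :
    mOrbits I E s t α S * Fintype.card (QGl I α S) =
      ∑ g : QGl I α S, ∏ a, Nat.card {M : Matrix (Fin (α (t a))) (Fin (α (s a))) S //
        (g (t a)).val * M = M * (g (s a)).val} := by
  classical
  let _ := QRep.mulAction s t α S
  have : Fintype (QRep I E s t α S) := Fintype.ofFinite _
  rw [mOrbits_eq_card_quotient, Nat.card_eq_fintype_card,
    ← MulAction.sum_card_fixedBy_eq_card_orbits_mul_card_group]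
  simp only [← Nat.card_eq_fintype_card, card_fixedBy_QRep]

/-- Over a finite field `k` and a Frobenius `k`-algebra `R`, the number of isomorphism classes
of locally free representations of a quiver of rank `α` does not change when the orientation
of some of the arrows is changed. -/
theorem number_of_orbits_independent_of_orientation
    (k : Type) [Field k] [Fintype k]
    (R : Type) [CommRing R] [Algebra k R] [FiniteDimensional k R]
    (lam : R →ₗ[k] k) (hlam : ∀ J : Ideal R, J ≠ ⊥ → ∃ x ∈ J, lam x ≠ 0)
    (I E : Type) [Fintype I] [Fintype E] (s t s' t' : E → I)
    (hor : ∀ a : E, (s' a = s a ∧ t' a = t a) ∨ (s' a = t a ∧ t' a = s a))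
    (α : I → ℕ) :
    mOrbits I E s t α R = mOrbits I E s' t' α R := by
  classical
  have : Finite R := Module.finite_of_finite k
  have : Fintype (QGl I α R) := Fintype.ofFinite _
  refine Nat.eq_of_mul_eq_mul_right (Fintype.card_pos (α := QGl I α R)) ?_
  rw [mOrbits_mul_card_QGl, mOrbits_mul_card_QGl]
  refine Finset.sum_congr rfl fun g _ => Finset.prod_congr rfl fun a _ => ?_
  rcases hor a with ⟨hs, ht⟩ | ⟨hs, ht⟩
  · rw [hs, ht]
  · rw [hs, ht]
    exact card_intertwiners_comm lam hlam _ _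
end

section
/- Let k be a finite field, R a Frobenius k-algebra, Q = (I, E, s, t) a finite quiver, and α : I → ℕ a rank vector. Then m_α(Π_R(Q)) = m_α(R[ε]Q): the number of G_α(R)-orbits on the zero fibre μ_R^{-1}(0) of the moment map equals the number of G_α(R[ε])-orbits on Rep^α(Q, R[ε]), where R[ε] = R[ε]/(ε²) is the algebra of dual numbers over R. -/
open Matrix

/-- The `i`-th component of the moment map: for a representation `(M, Ms)` of the double
quiver (`M a` along each arrow `a` and `Ms a` along the reversed arrow `a*`),
`μ(M,Ms)_i = Σ_{a : t a = i} M_a M_{a*} − Σ_{a : s a = i} M_{a*} M_a`. -/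
noncomputable def momentMap (I E : Type) [DecidableEq I] [Fintype E] (s t : E → I) (α : I → ℕ)
    (S : Type) [CommRing S]
    (M : ∀ a : E, Matrix (Fin (α (t a))) (Fin (α (s a))) S)
    (Ms : ∀ a : E, Matrix (Fin (α (s a))) (Fin (α (t a))) S) (i : I) :
    Matrix (Fin (α i)) (Fin (α i)) S :=
  (∑ a : E, if h : t a = i then
      (M a * Ms a).submatrix (finCongr (congrArg α h.symm)) (finCongr (congrArg α h.symm))
    else 0)
  - ∑ a : E, if h : s a = i then
      (Ms a * M a).submatrix (finCongr (congrArg α h.symm)) (finCongr (congrArg α h.symm))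
    else 0

/-- `m_α(Π_S(Q))`: the number of `G_α(S)`-orbits on the zero fibre `μ_S⁻¹(0)` of the
moment map on representations of the double quiver. -/
noncomputable def mOrbitsPreproj (I E : Type) [DecidableEq I] [Fintype E] (s t : E → I)
    (α : I → ℕ) (S : Type) [CommRing S] : ℕ :=
  Nat.card {O : Set ((∀ a : E, Matrix (Fin (α (t a))) (Fin (α (s a))) S) ×
      (∀ a : E, Matrix (Fin (α (s a))) (Fin (α (t a))) S)) //
    ∃ p : (∀ a : E, Matrix (Fin (α (t a))) (Fin (α (s a))) S) ×
      (∀ a : E, Matrix (Fin (α (s a))) (Fin (α (t a))) S),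
      (∀ i : I, momentMap I E s t α S p.1 p.2 i = 0) ∧
      O = {q | ∃ g : QGl I α S,
        q.1 = (fun a => (g (t a)).val * p.1 a * (g (s a)).inv) ∧
        q.2 = (fun a => (g (s a)).val * p.2 a * (g (t a)).inv)}}

theorem Nat.card_subtype_prod_eq_sum {A B : Type*} [Fintype A] [Finite B] (P : A → B → Prop) :
    Nat.card {q : A × B // P q.1 q.2} = ∑ a, Nat.card {b : B // P a b} := by
  rw [Nat.card_congr (Equiv.subtypeProdEquivSigmaSubtype P), Nat.card_sigma]

/-- Burnside's lemma for the orbits contained in an invariant subset, with the action given as a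
function and the orbits as subsets. -/
theorem card_orbits_mul_card_eq_card_fixed {Γ X : Type*} [Group Γ] (act : Γ → X → X)
    (act_one : ∀ x, act 1 x = x) (act_mul : ∀ g h x, act (g * h) x = act g (act h x))
    (P : X → Prop) (hP : ∀ g x, P x → P (act g x)) :
    Nat.card {O : Set X // ∃ x, P x ∧ O = {y | ∃ g, y = act g x}} * Nat.card Γ =
      Nat.card {q : Γ × X // P q.2 ∧ act q.1 q.2 = q.2} := by
  let _ : MulAction Γ {x // P x} :=
    { smul := fun g x => ⟨act g x.1, hP g x.1 x.2⟩
      one_smul := fun x => Subtype.ext (act_one x.1)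
      mul_smul := fun g h x => Subtype.ext (act_mul g h x.1) }
  have smul_val (g : Γ) (x : {x // P x}) : (g • x).1 = act g x.1 := rfl
  let toSet : {x // P x} → {O : Set X // ∃ x, P x ∧ O = {y | ∃ g, y = act g x}} :=
    fun x => ⟨{y | ∃ g, y = act g x.1}, x.1, x.2, rfl⟩
  have toSet_eq_iff (x y : {x // P x}) : toSet x = toSet y ↔ MulAction.orbitRel Γ _ x y := by
    rw [MulAction.orbitRel_apply, MulAction.mem_orbit_iff]
    constructor
    · intro h
      have hx : x.1 ∈ (toSet y).1 := h ▸ ⟨1, (act_one x.1).symm⟩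
      obtain ⟨g, hg⟩ := hx
      exact ⟨g, Subtype.ext hg.symm⟩
    · rintro ⟨g, rfl⟩
      refine Subtype.ext (Set.ext fun z => ⟨?_, ?_⟩)
      · rintro ⟨h, rfl⟩
        exact ⟨h * g, (act_mul h g y.1).symm⟩
      · rintro ⟨h, rfl⟩
        refine ⟨h * g⁻¹, ?_⟩
        rw [smul_val, ← act_mul, inv_mul_cancel_right]
  let e : MulAction.orbitRel.Quotient Γ {x // P x} ≃
      {O : Set X // ∃ x, P x ∧ O = {y | ∃ g, y = act g x}} :=
    Equiv.ofBijective
      (Quotient.lift toSet fun x y h => (toSet_eq_iff x y).2 h)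
      ⟨by
        rintro ⟨x⟩ ⟨y⟩ h
        exact Quotient.sound ((toSet_eq_iff x y).1 h),
      by
        rintro ⟨_, x, hx, rfl⟩
        exact ⟨Quotient.mk _ ⟨x, hx⟩, rfl⟩⟩
  rw [← Nat.card_congr e, ← Nat.card_prod,
    ← Nat.card_congr (MulAction.sigmaFixedByEquivOrbitsProdGroup Γ {x // P x})]
  refine Nat.card_congr
    { toFun := fun q => ⟨(q.1, q.2.1.1), q.2.1.2, congrArg Subtype.val q.2.2⟩
      invFun := fun q => ⟨q.1.1, ⟨q.1.2, q.2.1⟩, Subtype.ext q.2.2⟩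
      left_inv := fun _ => rfl
      right_inv := fun _ => rfl }

/-- A perfect pairing identifies the functionals vanishing on the range of `φ`; counting them
compares the size of the cokernel of `φ` with that of its kernel. -/
theorem card_ker_mul_card_eq_card_mul_card_annihilator {k A B W : Type*} [Field k] [Finite k]
    [AddCommGroup A] [Module k A] [FiniteDimensional k A]
    [AddCommGroup B] [Module k B] [FiniteDimensional k B]
    [AddCommGroup W] [Module k W] [FiniteDimensional k W]
    (φ : A →ₗ[k] B) (b : W →ₗ[k] Module.Dual k B) (hb : Function.Injective b)
    (hdim : Module.finrank k W = Module.finrank k B) :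
    Nat.card {a : A // φ a = 0} * Nat.card B =
      Nat.card A * Nat.card {w : W // ∀ a, b w (φ a) = 0} := by
  let e : W ≃ₗ[k] Module.Dual k B :=
    b.linearEquivOfInjective hb (hdim.trans Subspace.dual_finrank_eq.symm)
  have hann : Nat.card {w : W // ∀ a, b w (φ a) = 0} =
      Nat.card (LinearMap.range φ).dualAnnihilator :=
    Nat.card_congr (e.toEquiv.subtypeEquiv fun w => by
      simp [Submodule.mem_dualAnnihilator, e])
  have hker : Nat.card {a : A // φ a = 0} = Nat.card (LinearMap.ker φ) := rfl
  rw [hann, hker, Module.natCard_eq_pow_finrank (K := k) (V := LinearMap.ker φ),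
    Module.natCard_eq_pow_finrank (K := k) (V := A), Module.natCard_eq_pow_finrank (K := k) (V := B),
    Module.natCard_eq_pow_finrank (K := k) (V := (LinearMap.range φ).dualAnnihilator),
    ← pow_add, ← pow_add]
  congr 1
  have h₁ := φ.finrank_range_add_finrank_ker
  have h₂ := Subspace.finrank_add_finrank_dualAnnihilator_eq (LinearMap.range φ)
  omega

theorem Matrix.map_fst_mul_dualNumber {l m n S : Type*} [Fintype m] [CommRing S]
    (A : Matrix l m (DualNumber S)) (B : Matrix m n (DualNumber S)) :
    (A * B).map TrivSqZeroExt.fst = A.map TrivSqZeroExt.fst * B.map TrivSqZeroExt.fst := by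
  ext i j
  simp [Matrix.mul_apply, TrivSqZeroExt.fst_sum]

theorem Matrix.map_snd_mul_dualNumber {l m n S : Type*} [Fintype m] [CommRing S]
    (A : Matrix l m (DualNumber S)) (B : Matrix m n (DualNumber S)) :
    (A * B).map TrivSqZeroExt.snd =
      A.map TrivSqZeroExt.fst * B.map TrivSqZeroExt.snd +
        A.map TrivSqZeroExt.snd * B.map TrivSqZeroExt.fst := by
  ext i j
  simp [Matrix.mul_apply, TrivSqZeroExt.snd_sum, Finset.sum_add_distrib, mul_comm]

theorem Matrix.map_snd_one_dualNumber {n S : Type*} [DecidableEq n] [CommRing S] :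
    (1 : Matrix n n (DualNumber S)).map TrivSqZeroExt.snd = 0 := by
  ext i j
  by_cases hij : i = j <;> simp [hij]

theorem Matrix.dualNumber_ext_iff {m n S : Type*} {A B : Matrix m n (DualNumber S)} :
    A = B ↔ A.map TrivSqZeroExt.fst = B.map TrivSqZeroExt.fst ∧
      A.map TrivSqZeroExt.snd = B.map TrivSqZeroExt.snd := by
  simp only [← Matrix.ext_iff, TrivSqZeroExt.ext_iff, Matrix.map_apply, forall_and]

/-- Invertible matrices over the dual numbers are of the form `g + ε h` with `g` invertible. -/
noncomputable def unitsMatrixDualNumberEquiv (n S : Type*) [Fintype n] [DecidableEq n]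
    [CommRing S] :
    (Matrix n n (DualNumber S))ˣ ≃ (Matrix n n S)ˣ × Matrix n n S where
  toFun u := (Units.map (TrivSqZeroExt.fstHom S S S).toRingHom.mapMatrix.toMonoidHom u,
    u.val.map TrivSqZeroExt.snd)
  invFun p :=
    { val := Matrix.of fun i j => (p.1.val i j, p.2 i j)
      inv := Matrix.of fun i j => (p.1.inv i j, -(p.1.inv * p.2 * p.1.inv) i j)
      val_inv := by
        rw [Matrix.dualNumber_ext_iff, Matrix.map_fst_mul_dualNumber,
          Matrix.map_snd_mul_dualNumber, Matrix.map_one _ rfl rfl]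
        change p.1.val * p.1.inv = 1 ∧
          p.1.val * -(p.1.inv * p.2 * p.1.inv) + p.2 * p.1.inv = Matrix.map 1 TrivSqZeroExt.snd
        rw [Matrix.map_snd_one_dualNumber]
        simp [← mul_assoc]
      inv_val := by
        rw [Matrix.dualNumber_ext_iff, Matrix.map_fst_mul_dualNumber,
          Matrix.map_snd_mul_dualNumber, Matrix.map_one _ rfl rfl]
        change p.1.inv * p.1.val = 1 ∧
          p.1.inv * p.2 + -(p.1.inv * p.2 * p.1.inv) * p.1.val = Matrix.map 1 TrivSqZeroExt.snd
        rw [Matrix.map_snd_one_dualNumber]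
        simp [mul_assoc] }
  left_inv _ := Units.ext rfl
  right_inv _ := Prod.ext (Units.ext rfl) rfl

theorem Matrix.units_mul_mul_inv_eq_iff {m n S : Type*} [Fintype m] [DecidableEq m] [Fintype n]
    [DecidableEq n] [CommRing S] (u : (Matrix m m S)ˣ) (v : (Matrix n n S)ˣ) (A B : Matrix m n S) :
    u.val * A * v.inv = B ↔ u.val * A = B * v.val := by
  constructor
  · rintro rfl
    rw [Matrix.mul_assoc _ v.inv, v.inv_val, Matrix.mul_one]
  · intro h
    rw [h, Matrix.mul_assoc, v.val_inv, Matrix.mul_one]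

/-- A functional that vanishes on no nonzero ideal makes the trace pairing of matrices
nondegenerate. -/
theorem Matrix.eq_zero_of_forall_apply_trace_mul_eq_zero {k R m n : Type*} [Field k] [CommRing R]
    [Algebra k R] [Fintype m] [Fintype n]
    (lam : R →ₗ[k] k) (hlam : ∀ J : Ideal R, J ≠ ⊥ → ∃ x ∈ J, lam x ≠ 0)
    (A : Matrix m n R) (hA : ∀ N : Matrix n m R, lam (A * N).trace = 0) : A = 0 := by
  classical
  ext i j
  by_contra hij
  obtain ⟨x, hx, hx0⟩ := hlam (Ideal.span {A i j}) (by simpa using hij)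
  obtain ⟨r, rfl⟩ := Ideal.mem_span_singleton'.1 hx
  apply hx0
  rw [← hA (Matrix.single j i r), Matrix.trace_mul_single, mul_comm]
  simp

section Quiver

variable {I E : Type} {s t : E → I} {α : I → ℕ} {S : Type} [CommRing S]

theorem QAct_one (M : QRep I E s t α S) : QAct s t α 1 M = M := by
  funext a
  simp [QAct]

theorem QAct_mul (g h : QGl I α S) (M : QRep I E s t α S) :
    QAct s t α (g * h) M = QAct s t α g (QAct s t α h M) := by
  funext a
  simp [QAct, Matrix.mul_assoc]

theorem QAct_eq_self_iff (g : QGl I α S) (M : QRep I E s t α S) :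
    QAct s t α g M = M ↔ ∀ a, (g (t a)).val * M a = M a * (g (s a)).val := by
  simp only [funext_iff, QAct, Matrix.units_mul_mul_inv_eq_iff]

theorem momentMap_QAct [DecidableEq I] [Fintype E] (g : QGl I α S) (M : QRep I E s t α S)
    (Ms : QRep I E t s α S) (i : I) :
    momentMap I E s t α S (QAct s t α g M) (QAct t s α g Ms) i =
      (g i).val * momentMap I E s t α S M Ms i * (g i).inv := by
  simp only [momentMap, Matrix.mul_sub, Matrix.sub_mul, Matrix.mul_sum, Matrix.sum_mul]
  congr 1 <;> refine Finset.sum_congr rfl fun a _ => ?_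
  · split_ifs with h
    · subst h
      have key : QAct s t α g M a * QAct t s α g Ms a =
          (g (t a)).val * (M a * Ms a) * (g (t a)).inv := by
        simp only [QAct, Matrix.mul_assoc]
        rw [← Matrix.mul_assoc (g (s a)).inv, (g (s a)).inv_val, Matrix.one_mul]
      exact key
    · simp
  · split_ifs with h
    · subst h
      have key : QAct t s α g Ms a * QAct s t α g M a =
          (g (s a)).val * (Ms a * M a) * (g (s a)).inv := by
        simp only [QAct, Matrix.mul_assoc]
        rw [← Matrix.mul_assoc (g (t a)).inv, (g (t a)).inv_val, Matrix.one_mul]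
      exact key
    · simp

/-- The moment map is dual to the infinitesimal action with respect to the trace pairing. -/
theorem sum_trace_momentMap_mul [DecidableEq I] [Fintype I] [Fintype E] (M : QRep I E s t α S)
    (Ms : QRep I E t s α S) (h : ∀ i, Matrix (Fin (α i)) (Fin (α i)) S) :
    ∑ i, (momentMap I E s t α S M Ms i * h i).trace =
      ∑ a, (Ms a * (h (t a) * M a - M a * h (s a))).trace := by
  have aux (r : E → I) (A : ∀ a, Matrix (Fin (α (r a))) (Fin (α (r a))) S) :
      ∑ i, ((∑ a, if hr : r a = i then (A a).submatrix (finCongr (congrArg α hr.symm))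
        (finCongr (congrArg α hr.symm)) else 0) * h i).trace = ∑ a, (A a * h (r a)).trace := by
    simp only [Matrix.sum_mul, Matrix.trace_sum]
    rw [Finset.sum_comm]
    refine Finset.sum_congr rfl fun a _ => ?_
    rw [Finset.sum_eq_single (r a)]
    · rw [dif_pos rfl]
      rfl
    · intro i _ hi
      rw [dif_neg hi.symm]
      simp
    · simp
  simp only [momentMap, Matrix.sub_mul, Matrix.trace_sub, Finset.sum_sub_distrib, aux t, aux s,
    Matrix.mul_sub]
  congr 1 <;> refine Finset.sum_congr rfl fun a _ => ?_
  · rw [Matrix.mul_assoc, Matrix.trace_mul_comm, Matrix.mul_assoc, Matrix.trace_mul_comm,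
      Matrix.mul_assoc]
  · rw [Matrix.mul_assoc]

/-- Representations over the dual numbers are pairs of representations. -/
def QRep.dualNumberEquiv : QRep I E s t α (DualNumber S) ≃ QRep I E s t α S × QRep I E s t α S where
  toFun x := (fun a => (x a).map TrivSqZeroExt.fst, fun a => (x a).map TrivSqZeroExt.snd)
  invFun p := fun a => Matrix.of fun i j => (p.1 a i j, p.2 a i j)
  left_inv _ := rfl
  right_inv _ := rfl

/-- `G_α` of the dual numbers is the tangent bundle of `G_α`. -/
noncomputable def QGl.dualNumberEquiv :
    QGl I α (DualNumber S) ≃ QGl I α S × (∀ i, Matrix (Fin (α i)) (Fin (α i)) S) where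
  toFun γ := (fun i => (unitsMatrixDualNumberEquiv _ S (γ i)).1,
    fun i => (unitsMatrixDualNumberEquiv _ S (γ i)).2)
  invFun p := fun i => (unitsMatrixDualNumberEquiv _ S).symm (p.1 i, p.2 i)
  left_inv γ := by simp
  right_inv p := by simp

theorem QAct_dualNumber_eq_self_iff (γ : QGl I α (DualNumber S))
    (x : QRep I E s t α (DualNumber S)) :
    QAct s t α γ x = x ↔
      QAct s t α (QGl.dualNumberEquiv γ).1 (QRep.dualNumberEquiv x).1 =
          (QRep.dualNumberEquiv x).1 ∧
        ∀ a, ((QGl.dualNumberEquiv γ).1 (t a)).val * (QRep.dualNumberEquiv x).2 a +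
            (QGl.dualNumberEquiv γ).2 (t a) * (QRep.dualNumberEquiv x).1 a =
          (QRep.dualNumberEquiv x).1 a * (QGl.dualNumberEquiv γ).2 (s a) +
            (QRep.dualNumberEquiv x).2 a * ((QGl.dualNumberEquiv γ).1 (s a)).val := by
  simp only [QAct_eq_self_iff, Matrix.dualNumber_ext_iff, Matrix.map_fst_mul_dualNumber,
    Matrix.map_snd_mul_dualNumber, forall_and]
  rfl

variable {k : Type} [Field k] [Algebra k S]

/-- The linear part, in the directions `(h, N)`, of the equation `g M = M g` at `(g, M)`. -/
def commutatorDifferential (k : Type) [Field k] [Algebra k S] (g : QGl I α S)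
    (M : QRep I E s t α S) :
    (∀ i, Matrix (Fin (α i)) (Fin (α i)) S) × QRep I E s t α S →ₗ[k] QRep I E s t α S where
  toFun q := fun a => ((g (t a)).val * q.2 a - q.2 a * (g (s a)).val) +
    (q.1 (t a) * M a - M a * q.1 (s a))
  map_add' p q := by
    funext a
    simp only [Prod.fst_add, Prod.snd_add, Pi.add_apply, Matrix.mul_add, Matrix.add_mul]
    abel
  map_smul' c q := by
    funext a
    simp [smul_sub]

/-- The pairing of a representation of the opposite quiver with one of the quiver, obtained from
the trace and a linear form. -/
def tracePairing [Fintype E] (lam : S →ₗ[k] k) :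
    QRep I E t s α S →ₗ[k] Module.Dual k (QRep I E s t α S) :=
  LinearMap.mk₂ k (fun Ms N => lam (∑ a, (Ms a * N a).trace))
    (fun _ _ _ => by simp [Matrix.add_mul, Finset.sum_add_distrib])
    (fun _ _ _ => by simp [Finset.mul_sum])
    (fun _ _ _ => by simp [Matrix.mul_add, Finset.sum_add_distrib])
    (fun _ _ _ => by simp [Finset.mul_sum])

theorem tracePairing_apply [Fintype E] (lam : S →ₗ[k] k) (Ms : QRep I E t s α S)
    (N : QRep I E s t α S) : tracePairing lam Ms N = lam (∑ a, (Ms a * N a).trace) := rfl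

theorem eq_zero_of_forall_sum_trace_mul_eq_zero {ι : Type*} [Fintype ι] {m n : ι → Type*}
    [∀ i, Fintype (m i)] [∀ i, Fintype (n i)]
    (lam : S →ₗ[k] k) (hlam : ∀ J : Ideal S, J ≠ ⊥ → ∃ x ∈ J, lam x ≠ 0)
    (A : ∀ i, Matrix (m i) (n i) S)
    (hA : ∀ N : ∀ i, Matrix (n i) (m i) S, lam (∑ i, (A i * N i).trace) = 0) : A = 0 := by
  classical
  funext i
  refine Matrix.eq_zero_of_forall_apply_trace_mul_eq_zero lam hlam _ fun N => ?_
  rw [← hA (Pi.single i N), Finset.sum_eq_single i]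
  · simp
  · intro j _ hj
    simp [Pi.single_eq_of_ne hj]
  · simp

theorem tracePairing_injective [Fintype E] (lam : S →ₗ[k] k)
    (hlam : ∀ J : Ideal S, J ≠ ⊥ → ∃ x ∈ J, lam x ≠ 0) :
    Function.Injective (tracePairing (s := s) (t := t) (α := α) lam) :=
  (injective_iff_map_eq_zero _).2 fun Ms h =>
    eq_zero_of_forall_sum_trace_mul_eq_zero lam hlam Ms fun N => LinearMap.congr_fun h N

theorem forall_tracePairing_commutatorDifferential_eq_zero_iff [DecidableEq I] [Fintype I]
    [Fintype E] (lam : S →ₗ[k] k) (hlam : ∀ J : Ideal S, J ≠ ⊥ → ∃ x ∈ J, lam x ≠ 0)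
    (g : QGl I α S) (M : QRep I E s t α S) (Ms : QRep I E t s α S) :
    (∀ q, tracePairing lam Ms (commutatorDifferential k g M q) = 0) ↔
      (∀ i, momentMap I E s t α S M Ms i = 0) ∧ QAct t s α g Ms = Ms := by
  have key (q) : tracePairing lam Ms (commutatorDifferential k g M q) =
      lam (∑ a, ((Ms a * (g (t a)).val - (g (s a)).val * Ms a) * q.2 a).trace) +
        lam (∑ i, (momentMap I E s t α S M Ms i * q.1 i).trace) := by
    rw [sum_trace_momentMap_mul, tracePairing_apply, ← map_add, ← Finset.sum_add_distrib]
    refine congrArg lam (Finset.sum_congr rfl fun a _ => ?_)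
    simp only [commutatorDifferential, LinearMap.coe_mk, AddHom.coe_mk, Matrix.mul_add,
      Matrix.trace_add, Matrix.mul_sub, Matrix.sub_mul, Matrix.trace_sub]
    rw [← Matrix.mul_assoc (Ms a) (q.2 a), Matrix.trace_mul_comm (Ms a * q.2 a),
      Matrix.mul_assoc (Ms a), Matrix.mul_assoc (g (s a)).val]
  rw [QAct_eq_self_iff]
  simp only [key]
  constructor
  · intro h
    constructor
    · refine funext_iff.1 (eq_zero_of_forall_sum_trace_mul_eq_zero lam hlam _ fun N => ?_)
      simpa using h (N, 0)
    · intro a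
      refine (sub_eq_zero.1 (congrFun (eq_zero_of_forall_sum_trace_mul_eq_zero lam hlam
        (fun a => Ms a * (g (t a)).val - (g (s a)).val * Ms a) fun N => ?_) a)).symm
      simpa using h (0, N)
  · rintro ⟨h₁, h₂⟩ q
    simp [h₁, h₂]

/-- The linear equation for the direction `(h, N)` and the two dual conditions on `Ms` have solution
sets whose sizes differ by the factor `|𝔤|`. -/
theorem card_ker_commutatorDifferential [Finite k] [Module.Finite k S] [DecidableEq I] [Fintype I]
    [Fintype E] (lam : S →ₗ[k] k) (hlam : ∀ J : Ideal S, J ≠ ⊥ → ∃ x ∈ J, lam x ≠ 0)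
    (g : QGl I α S) (M : QRep I E s t α S) :
    Nat.card {q // commutatorDifferential k g M q = 0} =
      Nat.card (∀ i, Matrix (Fin (α i)) (Fin (α i)) S) *
        Nat.card {Ms : QRep I E t s α S //
          (∀ i, momentMap I E s t α S M Ms i = 0) ∧ QAct t s α g Ms = Ms} := by
  have : Finite S := Module.finite_of_finite k
  have hdim : Module.finrank k (QRep I E t s α S) = Module.finrank k (QRep I E s t α S) :=
    (LinearEquiv.piCongrRight fun a => Matrix.transposeLinearEquiv _ _ k S).finrank_eq
  have h := card_ker_mul_card_eq_card_mul_card_annihilator (commutatorDifferential k g M)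
    (tracePairing lam) (tracePairing_injective lam hlam) hdim
  simp only [forall_tracePairing_commutatorDifferential_eq_zero_iff lam hlam] at h
  rw [Nat.card_prod, mul_right_comm] at h
  exact Nat.eq_of_mul_eq_mul_right Nat.card_pos h

theorem mOrbits_mul_card (s t : E → I) (α : I → ℕ) :
    mOrbits I E s t α S * Nat.card (QGl I α S) =
      Nat.card {q : QGl I α S × QRep I E s t α S // QAct s t α q.1 q.2 = q.2} := by
  simpa only [true_and, mOrbits] using card_orbits_mul_card_eq_card_fixed (QAct s t α (S := S)) QAct_one
    QAct_mul (fun _ => True) fun _ _ _ => trivial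

theorem mOrbitsPreproj_mul_card [DecidableEq I] [Fintype E] (s t : E → I) (α : I → ℕ) :
    mOrbitsPreproj I E s t α S * Nat.card (QGl I α S) =
      Nat.card {q : (QGl I α S × QRep I E s t α S) × QRep I E t s α S //
        QAct s t α q.1.1 q.1.2 = q.1.2 ∧
          (∀ i, momentMap I E s t α S q.1.2 q.2 i = 0) ∧ QAct t s α q.1.1 q.2 = q.2} := by
  have h := card_orbits_mul_card_eq_card_fixed
    (fun (g : QGl I α S) (p : QRep I E s t α S × QRep I E t s α S) =>
      (QAct s t α g p.1, QAct t s α g p.2))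
    (fun p => by simp only [QAct_one])
    (fun g h p => by simp only [QAct_mul])
    (fun p => ∀ i, momentMap I E s t α S p.1 p.2 i = 0)
    (fun g p hp i => by simp [momentMap_QAct, hp])
  simp only [Prod.ext_iff] at h
  refine Eq.trans h (Nat.card_congr ((Equiv.prodAssoc _ _ _).symm.subtypeEquiv fun q => ?_))
  exact and_left_comm

theorem card_fixed_dualNumber [Finite k] [Module.Finite k S] [DecidableEq I] [Fintype I]
    [Fintype E] (lam : S →ₗ[k] k) (hlam : ∀ J : Ideal S, J ≠ ⊥ → ∃ x ∈ J, lam x ≠ 0)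
    (s t : E → I) (α : I → ℕ) :
    Nat.card {q : QGl I α (DualNumber S) × QRep I E s t α (DualNumber S) //
        QAct s t α q.1 q.2 = q.2} =
      Nat.card (∀ i, Matrix (Fin (α i)) (Fin (α i)) S) *
        Nat.card {q : (QGl I α S × QRep I E s t α S) × QRep I E t s α S //
          QAct s t α q.1.1 q.1.2 = q.1.2 ∧
            (∀ i, momentMap I E s t α S q.1.2 q.2 i = 0) ∧ QAct t s α q.1.1 q.2 = q.2} := by
  have : Finite S := Module.finite_of_finite k
  have : Fintype (QGl I α S × QRep I E s t α S) := Fintype.ofFinite _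
  rw [Nat.card_congr (((Equiv.prodCongr QGl.dualNumberEquiv QRep.dualNumberEquiv).trans
    (Equiv.prodProdProdComm _ _ _ _)).subtypeEquiv
    (q := fun q => QAct s t α q.1.1 q.1.2 = q.1.2 ∧ commutatorDifferential k q.1.1 q.1.2 q.2 = 0)
    fun q => ?_)]
  · rw [Nat.card_subtype_prod_eq_sum (fun (p : QGl I α S × QRep I E s t α S)
      (q : (∀ i, Matrix (Fin (α i)) (Fin (α i)) S) × QRep I E s t α S) =>
      QAct s t α p.1 p.2 = p.2 ∧ commutatorDifferential k p.1 p.2 q = 0), Nat.card_subtype_prod_eq_sum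
      (fun (p : QGl I α S × QRep I E s t α S) (Ms : QRep I E t s α S) =>
        QAct s t α p.1 p.2 = p.2 ∧
          (∀ i, momentMap I E s t α S p.2 Ms i = 0) ∧ QAct t s α p.1 Ms = Ms),
      Finset.mul_sum]
    refine Finset.sum_congr rfl fun p _ => ?_
    by_cases hp : QAct s t α p.1 p.2 = p.2
    · simpa only [hp, true_and] using card_ker_commutatorDifferential lam hlam p.1 p.2
    · simp [hp]
  · rw [QAct_dualNumber_eq_self_iff]
    refine and_congr_right fun _ => ?_
    rw [funext_iff]
    refine forall_congr' fun a => ?_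
    rw [← sub_eq_zero]
    refine Eq.congr_left ?_
    simp only [commutatorDifferential, LinearMap.coe_mk, AddHom.coe_mk, Equiv.trans_apply,
      Equiv.prodCongr_apply, Prod.map, Equiv.prodProdProdComm_apply]
    abel

end Quiver

/-- Over a finite field `k` and a Frobenius `k`-algebra `R`, the number of isomorphism
classes of locally free representations of the preprojective algebra `Π_R(Q)` of rank `α`
equals the number of isomorphism classes of locally free representations of `Q` of rank `α`
over the dual numbers `R[ε]`. -/
theorem preprojective_orbits_eq_dual_number_orbits
    (k : Type) [Field k] [Fintype k]
    (R : Type) [CommRing R] [Algebra k R] [FiniteDimensional k R]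
    (lam : R →ₗ[k] k) (hlam : ∀ J : Ideal R, J ≠ ⊥ → ∃ x ∈ J, lam x ≠ 0)
    (I E : Type) [DecidableEq I] [Fintype I] [Fintype E] (s t : E → I) (α : I → ℕ) :
    mOrbitsPreproj I E s t α R = mOrbits I E s t α (DualNumber R) := by
  have : Finite R := Module.finite_of_finite k
  have hG : Nat.card (QGl I α (DualNumber R)) =
      Nat.card (QGl I α R) * Nat.card (∀ i, Matrix (Fin (α i)) (Fin (α i)) R) := by
    rw [Nat.card_congr QGl.dualNumberEquiv, Nat.card_prod]
  have h := mOrbits_mul_card (S := DualNumber R) s t α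
  rw [card_fixed_dualNumber lam hlam, ← mOrbitsPreproj_mul_card, hG, ← mul_assoc,
    mul_comm (Nat.card _)] at h
  exact (Nat.eq_of_mul_eq_mul_right Nat.card_pos (Nat.eq_of_mul_eq_mul_right Nat.card_pos h)).symm
end
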